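/- There are exactly seventeen (2,0)-admissible data. (By Proposition 2.12 of the paper, these correspond bijectively to the twisted sectors of the inertia stack of the moduli stack M_2 of smooth genus 2 curves.) -/

import Mathlib

/-- A `(g,n)`-admissible datum (Definition 2.2 of the paper): a tuple
`(g', N, d₁, …, d_{N−1}, a₁, …, a_{N−1})` of natural numbers with `N ≥ 2`,
where `d` and `a` are encoded as functions `ℕ → ℕ` vanishing outside `{1, …, N−1}`,
satisfying the Riemann–Hurwitz formula, the congruence `Σ i·dᵢ ≡ 0 (mod N)`,
`Σ aᵢ = n`, `aᵢ ≤ dᵢ`, and `aᵢ = 0` whenever `gcd(i, N) ≠ 1`. -/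
structure AdmissibleDatum (g n : ℕ) where
  g' : ℕ
  N : ℕ
  hN : 2 ≤ N
  d : ℕ → ℕ
  a : ℕ → ℕ
  hd : ∀ i : ℕ, i ∉ Finset.Ico 1 N → d i = 0
  ha : ∀ i : ℕ, i ∉ Finset.Ico 1 N → a i = 0
  hRH : (2 * (g : ℤ) - 2) = (N : ℤ) * (2 * (g' : ℤ) - 2) +
      ∑ i ∈ Finset.Ico 1 N,
        (d i : ℤ) * (Nat.gcd i N : ℤ) * (((N / Nat.gcd i N : ℕ) : ℤ) - 1)
  hmod : ((∑ i ∈ Finset.Ico 1 N, i * d i : ℕ) : ZMod N) = 0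
  hsum : ∑ i ∈ Finset.Ico 1 N, a i = n
  hle : ∀ i : ℕ, a i ≤ d i
  hcop : ∀ i : ℕ, Nat.gcd i N ≠ 1 → a i = 0

/-- Encoding of a `(2,0)`-datum: `(g', N, s)` where `s` is the multiset with multiplicities `d`. -/
def GoodTriple (t : ℕ × ℕ × Multiset ℕ) : Prop :=
  2 ≤ t.2.1 ∧ (∀ x ∈ t.2.2, x ∈ Finset.Ico 1 t.2.1) ∧
    (t.2.2.map (fun x => t.2.1 - Nat.gcd x t.2.1)).sum + 2 * t.2.1 * t.1 = 2 * t.2.1 + 2 ∧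
    t.2.1 ∣ t.2.2.sum

instance : DecidablePred GoodTriple := fun t => by unfold GoodTriple; infer_instance

/-- The explicit list of the seventeen data. -/
def goodList : Finset (ℕ × ℕ × Multiset ℕ) :=
  {(1, 2, {1, 1}), (0, 2, {1, 1, 1, 1, 1, 1}), (0, 3, {1, 1, 2, 2}), (0, 4, {1, 2, 2, 3}),
   (0, 5, {1, 1, 3}), (0, 5, {1, 2, 2}), (0, 5, {2, 4, 4}), (0, 5, {3, 3, 4}),
   (0, 6, {1, 1, 4}), (0, 6, {2, 5, 5}), (0, 6, {2, 3, 3, 4}),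
   (0, 8, {1, 3, 4}), (0, 8, {4, 5, 7}),
   (0, 10, {1, 4, 5}), (0, 10, {2, 3, 5}), (0, 10, {5, 6, 9}), (0, 10, {5, 7, 8})}

lemma goodList_card : goodList.card = 17 := by decide +kernel

lemma goodList_good : ∀ t ∈ goodList, GoodTriple t := by decide +kernel

lemma sum_map_eq (N : ℕ) (s : Multiset ℕ) (hs : ∀ x ∈ s, x ∈ Finset.Ico 1 N) (f : ℕ → ℕ) :
    (s.map f).sum = ∑ i ∈ Finset.Ico 1 N, s.count i * f i := by
  rw [Finset.sum_multiset_map_count]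
  simp only [smul_eq_mul]
  apply Finset.sum_subset
  · intro x hx
    exact hs x (by simpa using hx)
  · intro x _ hx
    have : s.count x = 0 := by simpa using hx
    simp [this]

lemma weight_cast (N i : ℕ) (hN : 2 ≤ N) :
    (Nat.gcd i N : ℤ) * (((N / Nat.gcd i N : ℕ) : ℤ) - 1) = ((N - Nat.gcd i N : ℕ) : ℤ) := by
  have h1 : Nat.gcd i N ∣ N := Nat.gcd_dvd_right i N
  have h2 : Nat.gcd i N ≤ N := Nat.le_of_dvd (by omega) h1
  rw [Nat.cast_sub h2, mul_sub, mul_one, ← Nat.cast_mul, Nat.mul_div_cancel' h1]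

lemma RH_iff (N g' : ℕ) (hN : 2 ≤ N) (d : ℕ → ℕ) :
    ((2 * ((2 : ℕ) : ℤ) - 2) = (N : ℤ) * (2 * (g' : ℤ) - 2) +
      ∑ i ∈ Finset.Ico 1 N,
        (d i : ℤ) * (Nat.gcd i N : ℤ) * (((N / Nat.gcd i N : ℕ) : ℤ) - 1)) ↔
    (∑ i ∈ Finset.Ico 1 N, d i * (N - Nat.gcd i N)) + 2 * N * g' = 2 * N + 2 := by
  have : ∑ i ∈ Finset.Ico 1 N,
        (d i : ℤ) * (Nat.gcd i N : ℤ) * (((N / Nat.gcd i N : ℕ) : ℤ) - 1) =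
        ((∑ i ∈ Finset.Ico 1 N, d i * (N - Nat.gcd i N) : ℕ) : ℤ) := by
    rw [Nat.cast_sum]
    refine Finset.sum_congr rfl fun i _ => ?_
    rw [mul_assoc, weight_cast N i hN, Nat.cast_mul]
  rw [this]
  generalize (∑ i ∈ Finset.Ico 1 N, d i * (N - Nat.gcd i N)) = S
  zify
  constructor <;> intro h <;> push_cast at * <;> linarith

/-- The multiset attached to a multiplicity function. -/
def toMs (N : ℕ) (d : ℕ → ℕ) : Multiset ℕ := ∑ i ∈ Finset.Ico 1 N, d i • ({i} : Multiset ℕ)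

lemma count_toMs (N : ℕ) (d : ℕ → ℕ) (hd : ∀ i, i ∉ Finset.Ico 1 N → d i = 0) (j : ℕ) :
    (toMs N d).count j = d j := by
  unfold toMs
  rw [Multiset.count_sum']
  simp only [Multiset.count_nsmul, Multiset.count_singleton, mul_ite, mul_one, mul_zero]
  rw [Finset.sum_ite_eq]
  split_ifs with h
  · rfl
  · exact (hd j h).symm

lemma mem_toMs (N : ℕ) (d : ℕ → ℕ) (hd : ∀ i, i ∉ Finset.Ico 1 N → d i = 0) :
    ∀ x ∈ toMs N d, x ∈ Finset.Ico 1 N := by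
  intro x hx
  by_contra h
  have := Multiset.count_pos.2 hx
  rw [count_toMs N d hd, hd x h] at this
  omega

lemma a_zero (D : AdmissibleDatum 2 0) : D.a = fun _ => 0 := by
  funext i
  by_cases h : i ∈ Finset.Ico 1 D.N
  · exact (Finset.sum_eq_zero_iff.1 D.hsum) i h
  · exact D.ha i h

lemma sum_eq_count (N : ℕ) (s : Multiset ℕ) (hs : ∀ x ∈ s, x ∈ Finset.Ico 1 N) :
    s.sum = ∑ i ∈ Finset.Ico 1 N, i * s.count i := by
  have := sum_map_eq N s hs (fun x => x)
  rw [Multiset.map_id'] at this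
  rw [this]
  exact Finset.sum_congr rfl fun i _ => mul_comm _ _

/-- The data are encoded by the good triples. -/
def datumEquiv : AdmissibleDatum 2 0 ≃ {t // GoodTriple t} where
  toFun D := ⟨(D.g', D.N, toMs D.N D.d), by
    have hm := mem_toMs D.N D.d D.hd
    refine ⟨D.hN, hm, ?_, ?_⟩
    · have := (RH_iff D.N D.g' D.hN D.d).1 D.hRH
      simp only
      rw [sum_map_eq D.N _ hm]
      simpa only [count_toMs D.N D.d D.hd] using this
    · have := D.hmod
      rw [ZMod.natCast_eq_zero_iff] at this
      simp only
      rw [sum_eq_count D.N _ hm]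
      simpa only [count_toMs D.N D.d D.hd] using this⟩
  invFun t :=
    { g' := t.1.1
      N := t.1.2.1
      hN := t.2.1
      d := fun i => t.1.2.2.count i
      a := fun _ => 0
      hd := fun i hi => Multiset.count_eq_zero.2 fun h => hi (t.2.2.1 i h)
      ha := fun _ _ => rfl
      hRH := by
        rw [RH_iff _ _ t.2.1, ← sum_map_eq _ _ t.2.2.1 (fun x => t.1.2.1 - Nat.gcd x t.1.2.1)]
        exact t.2.2.2.1
      hmod := by
        rw [ZMod.natCast_eq_zero_iff, ← sum_eq_count _ _ t.2.2.1]
        exact t.2.2.2.2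
      hsum := by simp
      hle := fun _ => Nat.zero_le _
      hcop := fun _ _ => rfl }
  left_inv D := by
    have ha := a_zero D
    have hc := count_toMs D.N D.d D.hd
    have hd : (fun i => (toMs D.N D.d).count i) = D.d := funext hc
    cases D
    simp only [AdmissibleDatum.mk.injEq] at *
    exact ⟨trivial, trivial, hd, ha.symm⟩
  right_inv t := by
    apply Subtype.ext
    refine Prod.ext rfl (Prod.ext rfl ?_)
    refine Multiset.ext.2 fun j => ?_
    exact count_toMs _ _ (fun i hi => Multiset.count_eq_zero.2 fun h => hi (t.2.2.1 i h)) j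

lemma bound_three_aux (N a b c : ℕ) (hN : 0 < N) (ha : a ∣ N) (hb : b ∣ N) (hc : c ∣ N)
    (hab : Nat.gcd a b ≤ 2) (hac : Nat.gcd a c ≤ 2) (h1 : b ≤ a) (h2 : c ≤ a)
    (hs : a + b + c + 2 = N) (h2a : 2 * a ≤ N) : N < 30 := by
  have key : ∀ e, e ∣ N → Nat.gcd a e ≤ 2 → a * e ≤ 2 * N := by
    intro e he hg
    rw [← Nat.gcd_mul_lcm a e]
    exact Nat.mul_le_mul hg (Nat.le_of_dvd hN (Nat.lcm_dvd ha he))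
  have k1 := key b hb hab
  have k2 := key c hc hac
  by_contra hlt
  have h3 : N ≤ 3 * a + 2 := by omega
  have h4 : N ≤ 2 * (b + c) + 4 := by omega
  have h5 : a * (b + c) ≤ 4 * N := by rw [mul_add]; omega
  obtain ⟨m, rfl⟩ : ∃ m, N = m + 30 := ⟨N - 30, by omega⟩
  have h6 : (m + 28) * (m + 26) ≤ (3 * a) * (2 * (b + c)) :=
    Nat.mul_le_mul (by omega) (by omega)
  nlinarith

lemma gcd_le_two (N x y z c : ℕ) (hN : 5 ≤ N) (hd : N ∣ x + y + z) (hc : c = Nat.gcd z N)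
    (hs : Nat.gcd x N + Nat.gcd y N + c + 2 = N) :
    Nat.gcd (Nat.gcd x N) (Nat.gcd y N) ≤ 2 := by
  set g := Nat.gcd (Nat.gcd x N) (Nat.gcd y N) with hg
  have g1 : g ∣ Nat.gcd x N := Nat.gcd_dvd_left _ _
  have g2 : g ∣ Nat.gcd y N := Nat.gcd_dvd_right _ _
  have gx : g ∣ x := g1.trans (Nat.gcd_dvd_left _ _)
  have gN : g ∣ N := g1.trans (Nat.gcd_dvd_right _ _)
  have gy : g ∣ y := g2.trans (Nat.gcd_dvd_left _ _)
  have gz : g ∣ z := (Nat.dvd_add_right (dvd_add gx gy)).1 (gN.trans hd)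
  have gc : g ∣ c := hc ▸ Nat.dvd_gcd gz gN
  have h2 : g ∣ 2 := by
    refine (Nat.dvd_add_right (dvd_add (dvd_add g1 g2) gc)).1 ?_
    rw [hs]; exact gN
  exact Nat.le_of_dvd (by norm_num) h2

lemma two_gcd_le (N x : ℕ) (hx : 1 ≤ x) (hxN : x < N) : 2 * Nat.gcd x N ≤ N := by
  obtain ⟨m, hm⟩ := Nat.gcd_dvd_right x N
  have hle : Nat.gcd x N ≤ x := Nat.le_of_dvd hx (Nat.gcd_dvd_left x N)
  generalize Nat.gcd x N = g at *
  rcases m with _ | _ | m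
  · omega
  · omega
  · nlinarith

lemma half_or (N x : ℕ) (hx : 1 ≤ x) (hxN : x < N) :
    (2 * x = N ∧ Nat.gcd x N = x) ∨ (3 * Nat.gcd x N ≤ N ∧ 2 * x ≠ N) := by
  by_cases h2 : 2 * x = N
  · left
    refine ⟨h2, ?_⟩
    rw [← h2]; simp
  right
  refine ⟨?_, h2⟩
  obtain ⟨m, hm⟩ := Nat.gcd_dvd_right x N
  obtain ⟨k, hk⟩ := Nat.gcd_dvd_left x N
  have hpos : 0 < Nat.gcd x N := Nat.gcd_pos_of_pos_left _ hx
  generalize Nat.gcd x N = g at *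
  rcases m with _ | _ | _ | m
  · omega
  · have : 0 < k := by rcases k with _ | k <;> omega
    nlinarith
  · have : 0 < k := by rcases k with _ | k <;> omega
    have : k < 2 := by nlinarith
    obtain rfl : k = 1 := by omega
    omega
  · nlinarith

lemma bound_three (N x y z : ℕ) (hN : 5 ≤ N) (hx : 1 ≤ x ∧ x < N) (hy : 1 ≤ y ∧ y < N)
    (hz : 1 ≤ z ∧ z < N) (hd : N ∣ x + y + z)
    (hs : Nat.gcd x N + Nat.gcd y N + Nat.gcd z N + 2 = N) : N < 30 := by
  have a1 := two_gcd_le N x hx.1 hx.2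
  have a2 := two_gcd_le N y hy.1 hy.2
  have a3 := two_gcd_le N z hz.1 hz.2
  have gxy := gcd_le_two N x y z _ hN hd rfl hs
  have gxz := gcd_le_two N x z y _ hN (by convert hd using 1; ring) rfl (by omega)
  have gyz := gcd_le_two N y z x _ hN (by convert hd using 1; ring) rfl (by omega)
  have dx := Nat.gcd_dvd_right x N
  have dy := Nat.gcd_dvd_right y N
  have dz := Nat.gcd_dvd_right z N
  generalize Nat.gcd x N = a at *
  generalize Nat.gcd y N = b at *
  generalize Nat.gcd z N = c at *
  have hN0 : 0 < N := by omega
  rcases le_total a b with h | h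
  · rcases le_total b c with h' | h'
    · exact bound_three_aux N c a b hN0 dz dx dy (by rwa [Nat.gcd_comm]) (by rwa [Nat.gcd_comm])
        (by omega) (by omega) (by omega) (by omega)
    · exact bound_three_aux N b a c hN0 dy dx dz (by rwa [Nat.gcd_comm]) gyz
        (by omega) (by omega) (by omega) (by omega)
  · rcases le_total a c with h' | h'
    · exact bound_three_aux N c a b hN0 dz dx dy (by rwa [Nat.gcd_comm]) (by rwa [Nat.gcd_comm])
        (by omega) (by omega) (by omega) (by omega)
    · exact bound_three_aux N a b c hN0 dx dy dz gxy gxz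
        (by omega) (by omega) (by omega) (by omega)

lemma bound_four (N x y z w : ℕ) (hN : 5 ≤ N) (hx : 1 ≤ x ∧ x < N) (hy : 1 ≤ y ∧ y < N)
    (hz : 1 ≤ z ∧ z < N) (hw : 1 ≤ w ∧ w < N) (hd : N ∣ x + y + z + w)
    (hs : Nat.gcd x N + Nat.gcd y N + Nat.gcd z N + Nat.gcd w N + 2 = 2 * N) : N < 7 := by
  have a1 := half_or N x hx.1 hx.2
  have a2 := half_or N y hy.1 hy.2
  have a3 := half_or N z hz.1 hz.2
  have a4 := half_or N w hw.1 hw.2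
  obtain ⟨q, hq⟩ := hd
  have hq4 : q < 4 := by nlinarith
  generalize Nat.gcd x N = a at *
  generalize Nat.gcd y N = b at *
  generalize Nat.gcd z N = c at *
  generalize Nat.gcd w N = e at *
  interval_cases q <;> omega

/-- Boolean test used in `check_three`; the cheap numerical condition is tested first. -/
def testThree (N x y q : ℕ) : Bool :=
  !(Nat.beq (Nat.gcd x N + Nat.gcd y N + Nat.gcd (N * q - (x + y)) N + 2) N) ||
    (!(Nat.ble (x + y + 1) (N * q)) || (!(Nat.ble (N * q - (x + y) + 1) N) ||
      decide (((0, N, {x, y, N * q - (x + y)}) : ℕ × ℕ × Multiset ℕ) ∈ goodList)))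

lemma testThree_all : ((List.range 30).all fun N => !(Nat.ble 5 N) ||
    (List.range N).all fun x => (List.range N).all fun y => (List.range 3).all fun q =>
      testThree N x y q) = true := by
  decide +kernel

lemma check_three (N : ℕ) (hN : N < 30) (h5 : 5 ≤ N) (x : ℕ) (hx : x < N) (y : ℕ) (hy : y < N)
    (q : ℕ) (hq : q < 3) (h : x + y < N * q ∧ N * q - (x + y) < N ∧
    Nat.gcd x N + Nat.gcd y N + Nat.gcd (N * q - (x + y)) N + 2 = N) :
    ((0, N, {x, y, N * q - (x + y)}) : ℕ × ℕ × Multiset ℕ) ∈ goodList := by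
  have h1 := List.all_eq_true.1 testThree_all N (List.mem_range.2 hN)
  rw [Nat.ble_eq_true_of_le h5, Bool.not_true, Bool.false_or] at h1
  have h2 := List.all_eq_true.1 h1 x (List.mem_range.2 hx)
  have h3 := List.all_eq_true.1 h2 y (List.mem_range.2 hy)
  have h4 := List.all_eq_true.1 h3 q (List.mem_range.2 hq)
  unfold testThree at h4
  rw [Nat.ble_eq_true_of_le (show x + y + 1 ≤ N * q from h.1),
    Nat.ble_eq_true_of_le (show N * q - (x + y) + 1 ≤ N from h.2.1),
    show Nat.beq (Nat.gcd x N + Nat.gcd y N + Nat.gcd (N * q - (x + y)) N + 2) N = true from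
      Nat.beq_eq.mpr h.2.2] at h4
  simpa only [Bool.not_true, Bool.false_or, decide_eq_true_eq] using h4

set_option synthInstance.maxHeartbeats 400000 in
set_option synthInstance.maxSize 4000 in
lemma check_four : ∀ N < 7, 5 ≤ N → ∀ x < N, ∀ y < N, ∀ z < N, ∀ w < N,
    ((1 ≤ x ∧ 1 ≤ y ∧ 1 ≤ z ∧ 1 ≤ w) ∧ N ∣ x + y + z + w ∧
    Nat.gcd x N + Nat.gcd y N + Nat.gcd z N + Nat.gcd w N + 2 = 2 * N) →
    ((0, N, {x, y, z, w}) : ℕ × ℕ × Multiset ℕ) ∈ goodList := by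
  intro N h7 h5
  interval_cases N
  · decide +kernel
  · decide +kernel

lemma ms_eq (N : ℕ) (s : Multiset ℕ) (hs : ∀ x ∈ s, x ∈ Finset.Ico 1 N) :
    s = toMs N (fun i => s.count i) := by
  refine Multiset.ext.2 fun j => ?_
  rw [count_toMs N _ (fun i hi => Multiset.count_eq_zero.2 fun h => hi (hs i h))]

lemma good_small (g N : ℕ) (s : Multiset ℕ) (hN5 : N < 5) (h : GoodTriple (g, N, s)) :
    (g, N, s) ∈ goodList := by
  obtain ⟨hN, hm, hsum, hdvd⟩ := h
  simp only at hN hm hsum hdvd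
  rw [sum_map_eq N s hm] at hsum
  rw [sum_eq_count N s hm] at hdvd
  rw [ms_eq N s hm]
  obtain ⟨d, hd⟩ : ∃ d : ℕ → ℕ, d = fun i => s.count i := ⟨_, rfl⟩
  rw [← hd]
  have hd' : ∀ i, s.count i = d i := fun i => by rw [hd]
  simp only [hd'] at hsum hdvd
  clear hd hd' hm
  interval_cases N
  · have e : Finset.Ico 1 2 = {1} := by decide
    simp only [toMs, e, Finset.sum_singleton] at hsum hdvd ⊢
    generalize d 1 = a at *
    norm_num at hsum
    have hg : g < 2 := by omega
    interval_cases g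
    · obtain rfl : a = 6 := by omega
      decide +kernel
    · obtain rfl : a = 2 := by omega
      decide +kernel
  · have e : Finset.Ico 1 3 = {1, 2} := by decide
    simp only [toMs, e, Finset.sum_pair (show (1 : ℕ) ≠ 2 by decide)] at hsum hdvd ⊢
    generalize d 1 = a at *
    generalize d 2 = b at *
    norm_num at hsum
    have hg : g < 2 := by omega
    interval_cases g
    · obtain rfl : b = 2 := by omega
      obtain rfl : a = 2 := by omega
      decide +kernel
    · omega
  · have e : Finset.Ico 1 4 = {1, 2, 3} := by decide
    have e' : ∀ {M : Type} [AddCommMonoid M] (f : ℕ → M),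
        ∑ i ∈ ({1, 2, 3} : Finset ℕ), f i = f 1 + (f 2 + f 3) := by
      intro M _ f
      rw [Finset.sum_insert (by decide), Finset.sum_pair (by decide)]
    simp only [toMs, e, e'] at hsum hdvd ⊢
    generalize d 1 = a at *
    generalize d 2 = b at *
    generalize d 3 = c at *
    norm_num at hsum
    have hg : g < 2 := by omega
    interval_cases g
    · obtain rfl : b = 2 := by omega
      obtain rfl : a = 1 := by omega
      obtain rfl : c = 1 := by omega
      decide +kernel
    · omega

lemma card_bounds (N : ℕ) (s : Multiset ℕ) (hs : ∀ x ∈ s, x ∈ Finset.Ico 1 N) :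
    N * s.card ≤ 2 * (s.map (fun x => N - Nat.gcd x N)).sum ∧
    (s.map (fun x => N - Nat.gcd x N)).sum + s.card ≤ N * s.card := by
  induction s using Multiset.induction with
  | empty => simp
  | cons a s ih =>
    have ih := ih fun x hx => hs x (Multiset.mem_cons_of_mem hx)
    have ha := Finset.mem_Ico.1 (hs a (Multiset.mem_cons_self a s))
    have h1 := two_gcd_le N a ha.1 ha.2
    have h2 : 0 < Nat.gcd a N := Nat.gcd_pos_of_pos_left _ ha.1
    simp only [Multiset.map_cons, Multiset.sum_cons, Multiset.card_cons, mul_add, mul_one]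
    omega

lemma good_large (g N : ℕ) (s : Multiset ℕ) (hN5 : 5 ≤ N) (h : GoodTriple (g, N, s)) :
    (g, N, s) ∈ goodList := by
  obtain ⟨hN, hm, hsum, hdvd⟩ := h
  simp only at hN hm hsum hdvd
  obtain ⟨c1, c2⟩ := card_bounds N s hm
  have hk5 : s.card < 5 := by
    by_contra hk
    nlinarith
  have hg : g = 0 := by
    have : g < 2 := by nlinarith
    interval_cases g
    · rfl
    · have hk : s.card = 0 := by
        by_contra hk
        have : 1 ≤ s.card := by omega
        nlinarith
      rw [hk] at c1 c2
      omega
  subst hg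
  have hk : s.card = 3 ∨ s.card = 4 := by
    interval_cases s.card <;> omega
  clear c1 c2 hk5
  rcases hk with hk | hk
  · obtain ⟨x, y, z, rfl⟩ := Multiset.card_eq_three.1 hk
    have hx := Finset.mem_Ico.1 (hm x (by simp))
    have hy := Finset.mem_Ico.1 (hm y (by simp))
    have hz := Finset.mem_Ico.1 (hm z (by simp))
    have b1 := two_gcd_le N x hx.1 hx.2
    have b2 := two_gcd_le N y hy.1 hy.2
    have b3 := two_gcd_le N z hz.1 hz.2
    simp only [Multiset.insert_eq_cons, Multiset.map_cons, Multiset.map_singleton,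
      Multiset.sum_cons, Multiset.sum_singleton] at hsum hdvd
    rw [← add_assoc] at hdvd
    have hs : Nat.gcd x N + Nat.gcd y N + Nat.gcd z N + 2 = N := by omega
    have hb := bound_three N x y z hN5 hx hy hz hdvd hs
    obtain ⟨q, hq⟩ := hdvd
    have hq3 : q < 3 := by nlinarith
    obtain rfl : z = N * q - (x + y) := by omega
    exact check_three N hb hN5 x hx.2 y hy.2 q hq3 ⟨by omega, hz.2, hs⟩
  · obtain ⟨x, hxs⟩ := Multiset.card_pos_iff_exists_mem.1 (by omega : 0 < s.card)
    obtain ⟨t, rfl⟩ := Multiset.exists_cons_of_mem hxs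
    have ht : t.card = 3 := by simpa using hk
    obtain ⟨y, z, w, rfl⟩ := Multiset.card_eq_three.1 ht
    have hx := Finset.mem_Ico.1 (hm x (by simp))
    have hy := Finset.mem_Ico.1 (hm y (by simp))
    have hz := Finset.mem_Ico.1 (hm z (by simp))
    have hw := Finset.mem_Ico.1 (hm w (by simp))
    have b1 := two_gcd_le N x hx.1 hx.2
    have b2 := two_gcd_le N y hy.1 hy.2
    have b3 := two_gcd_le N z hz.1 hz.2
    have b4 := two_gcd_le N w hw.1 hw.2
    simp only [Multiset.insert_eq_cons, Multiset.map_cons, Multiset.map_singleton,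
      Multiset.sum_cons, Multiset.sum_singleton] at hsum hdvd
    rw [← add_assoc, ← add_assoc] at hdvd
    have hs : Nat.gcd x N + Nat.gcd y N + Nat.gcd z N + Nat.gcd w N + 2 = 2 * N := by omega
    have hb := bound_four N x y z w hN5 hx hy hz hw hdvd hs
    exact check_four N hb hN5 x hx.2 y hy.2 z hz.2 w hw.2
      ⟨⟨hx.1, hy.1, hz.1, hw.1⟩, hdvd, hs⟩

/-- There are exactly seventeen `(2,0)`-admissible data. -/
theorem card_admissibleDatum_two_zero : Nat.card (AdmissibleDatum 2 0) = 17 := by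
  
  rw [Nat.card_congr datumEquiv]
  have h : ∀ t, GoodTriple t ↔ t ∈ goodList := by
    rintro ⟨g, N, s⟩
    refine ⟨fun h => ?_, goodList_good _⟩
    rcases Nat.lt_or_ge N 5 with hN | hN
    · exact good_small g N s hN h
    · exact good_large g N s hN h
  rw [Nat.card_congr (Equiv.subtypeEquivRight h), Nat.card_eq_fintype_card, Fintype.card_coe,
    goodList_card]
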